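/- Let K = [k₁, k₂] with 0 < k₁ ≤ k₂. The unique function F : L([0,1])² → L([0,1]) that is migrative, homogeneous of order K, and satisfies F([1,1],[1,1]) = [1,1], is given by F(X,Y) = (XY)^{K/2} = [(x̲·y̲)^{k₂/2}, (x̄·ȳ)^{k₁/2}]. -/

import Mathlib

/-! Closed subintervals of the unit interval, interval-valued overlap functions,
and related notions. -/

/-- The set `L([0,1])` of closed subintervals `[lo, hi]` of `[0,1]`. -/
@[ext]
structure IV : Type where
  lo : ℝ
  hi : ℝ
  lo_nonneg : 0 ≤ lo
  lo_le_hi : lo ≤ hi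
  hi_le_one : hi ≤ 1

namespace IV

/-- The degenerate interval `[0,0]`. -/
instance : Zero IV := ⟨⟨0, 0, le_refl 0, le_refl 0, zero_le_one⟩⟩

/-- The degenerate interval `[1,1]`. -/
instance : One IV := ⟨⟨1, 1, zero_le_one, le_refl 1, le_refl 1⟩⟩

/-- Interval product: `X * Y = [x̲·y̲, x̄·ȳ]`. -/
instance : Mul IV :=
  ⟨fun X Y =>
    ⟨X.lo * Y.lo, X.hi * Y.hi, mul_nonneg X.lo_nonneg Y.lo_nonneg,
      mul_le_mul X.lo_le_hi Y.lo_le_hi Y.lo_nonneg (X.lo_nonneg.trans X.lo_le_hi),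
      mul_le_one₀ X.hi_le_one (Y.lo_nonneg.trans Y.lo_le_hi) Y.hi_le_one⟩⟩

/-- The product (componentwise) order on intervals. -/
instance : LE IV := ⟨fun X Y => X.lo ≤ Y.lo ∧ X.hi ≤ Y.hi⟩

/-- Componentwise maximum of intervals: `X ∨ Y`. -/
instance : Max IV :=
  ⟨fun X Y =>
    ⟨max X.lo Y.lo, max X.hi Y.hi, le_max_of_le_left X.lo_nonneg,
      max_le_max X.lo_le_hi Y.lo_le_hi, max_le X.hi_le_one Y.hi_le_one⟩⟩

/-- Componentwise minimum of intervals: `X ∧ Y`. -/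
instance : Min IV :=
  ⟨fun X Y =>
    ⟨min X.lo Y.lo, min X.hi Y.hi, le_min X.lo_nonneg Y.lo_nonneg,
      min_le_min X.lo_le_hi Y.lo_le_hi, min_le_of_left_le X.hi_le_one⟩⟩

/-- Interval inclusion: `X ⊆ Y`. -/
def subs (X Y : IV) : Prop := Y.lo ≤ X.lo ∧ X.hi ≤ Y.hi

/-- The Moore metric on intervals. -/
noncomputable def mdist (X Y : IV) : ℝ := max |X.lo - Y.lo| |X.hi - Y.hi|

/-- Interval power with natural exponent: `Xⁿ = [x̲ⁿ, x̄ⁿ]`. -/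
def npow (X : IV) (n : ℕ) : IV :=
  ⟨X.lo ^ n, X.hi ^ n, pow_nonneg X.lo_nonneg n,
    pow_le_pow_left₀ X.lo_nonneg X.lo_le_hi n,
    pow_le_one₀ (X.lo_nonneg.trans X.lo_le_hi) X.hi_le_one⟩

/-- Interval `n`-th root: `X^{1/n} = [x̲^{1/n}, x̄^{1/n}]`. -/
noncomputable def nroot (X : IV) (n : ℕ) : IV :=
  ⟨X.lo ^ ((n : ℝ))⁻¹, X.hi ^ ((n : ℝ))⁻¹,
    Real.rpow_nonneg X.lo_nonneg _,
    Real.rpow_le_rpow X.lo_nonneg X.lo_le_hi (by positivity),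
    Real.rpow_le_one (X.lo_nonneg.trans X.lo_le_hi) X.hi_le_one (by positivity)⟩

/-- Interval complement: `Xᶜ = [1 - x̄, 1 - x̲]`. -/
def compl (X : IV) : IV :=
  ⟨1 - X.hi, 1 - X.lo, by linarith [X.hi_le_one], by linarith [X.lo_le_hi],
    by linarith [X.lo_nonneg]⟩

/-- Interval power with interval exponent `K = [k₁,k₂]`, `0 < k₁ ≤ k₂`:
`X^K = [x̲^{k₂}, x̄^{k₁}]`. -/
noncomputable def ipow (X : IV) (k₁ k₂ : ℝ) (hk₁ : 0 < k₁) (hk : k₁ ≤ k₂) : IV :=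
  ⟨X.lo ^ k₂, X.hi ^ k₁,
    Real.rpow_nonneg X.lo_nonneg _,
    by
      rcases eq_or_lt_of_le X.lo_nonneg with h | h
      · rw [← h, Real.zero_rpow (by linarith : k₂ ≠ 0)]
        exact Real.rpow_nonneg (X.lo_nonneg.trans X.lo_le_hi) _
      · calc X.lo ^ k₂ ≤ X.lo ^ k₁ :=
              Real.rpow_le_rpow_of_exponent_ge h (X.lo_le_hi.trans X.hi_le_one) hk
          _ ≤ X.hi ^ k₁ := Real.rpow_le_rpow X.lo_nonneg X.lo_le_hi hk₁.le,
    Real.rpow_le_one (X.lo_nonneg.trans X.lo_le_hi) X.hi_le_one hk₁.le⟩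

end IV

/-- The unit interval `[0,1]` of real numbers. -/
abbrev I01 := unitInterval

/-- The degenerate interval `[x,x]`. -/
def IV.diag (x : I01) : IV := ⟨x, x, x.2.1, le_refl _, x.2.2⟩

/-- The left endpoint, as an element of `[0,1]`. -/
def IV.loI (X : IV) : I01 := ⟨X.lo, X.lo_nonneg, X.lo_le_hi.trans X.hi_le_one⟩

/-- The right endpoint, as an element of `[0,1]`. -/
def IV.hiI (X : IV) : I01 := ⟨X.hi, X.lo_nonneg.trans X.lo_le_hi, X.hi_le_one⟩

/-- Moore continuity of a unary interval function. -/
def MooreCont1 (g : IV → IV) : Prop :=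
  ∀ X : IV, ∀ ε > (0 : ℝ), ∃ δ > (0 : ℝ), ∀ Y : IV,
    IV.mdist X Y < δ → IV.mdist (g X) (g Y) < ε

/-- Moore continuity of a binary interval function. -/
def MooreCont2 (O : IV → IV → IV) : Prop :=
  ∀ X Y : IV, ∀ ε > (0 : ℝ), ∃ δ > (0 : ℝ), ∀ X' Y' : IV,
    IV.mdist X X' < δ → IV.mdist Y Y' < δ → IV.mdist (O X Y) (O X' Y') < ε

/-- Interval-valued overlap function. -/
structure IVOverlap (O : IV → IV → IV) : Prop where
  comm : ∀ X Y, O X Y = O Y X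
  zero_iff : ∀ X Y, O X Y = 0 ↔ X * Y = 0
  one_iff : ∀ X Y, O X Y = 1 ↔ X * Y = 1
  mono : ∀ X Y Z, Y ≤ Z → O X Y ≤ O X Z
  cont : MooreCont2 O

/-- Migrativity of a binary interval function. -/
def Migrative (F : IV → IV → IV) : Prop := ∀ α X Y : IV, F (α * X) Y = F X (α * Y)

/-- (Real-valued) overlap function on `[0,1]`. -/
structure Overlap (G : I01 → I01 → I01) : Prop where
  comm : ∀ x y, G x y = G y x
  zero_iff : ∀ x y, G x y = 0 ↔ x * y = 0
  one_iff : ∀ x y, G x y = 1 ↔ x * y = 1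
  mono : ∀ x y z, y ≤ z → G x y ≤ G x z
  cont : Continuous (Function.uncurry G)

/-- Left projection of a binary interval function. -/
def lproj (O : IV → IV → IV) (x y : I01) : I01 := (O (IV.diag x) (IV.diag y)).loI

/-- Right projection of a binary interval function. -/
def rproj (O : IV → IV → IV) (x y : I01) : I01 := (O (IV.diag x) (IV.diag y)).hiI

/-- `O(X,Y) = [G₁(x̲,y̲), G₂(x̄,ȳ)]` for all `X, Y`. -/
def Represents (G₁ G₂ : I01 → I01 → I01) (O : IV → IV → IV) : Prop :=
  ∀ X Y : IV, (O X Y).lo = (G₁ X.loI Y.loI : ℝ) ∧ (O X Y).hi = (G₂ X.hiI Y.hiI : ℝ)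

/-- o-representability of an interval-valued overlap function. -/
def ORepresentable (O : IV → IV → IV) : Prop :=
  ∃ G₁ G₂ : I01 → I01 → I01, Overlap G₁ ∧ Overlap G₂ ∧
    (∀ x y, G₁ x y ≤ G₂ x y) ∧ Represents G₁ G₂ O

/-- Interval-valued t-norm. -/
structure IVTnorm (T : IV → IV → IV) : Prop where
  comm : ∀ X Y, T X Y = T Y X
  assoc : ∀ X Y Z, T X (T Y Z) = T (T X Y) Z
  mono : ∀ X Y Z, Y ≤ Z → T X Y ≤ T X Z
  one : ∀ X, T X 1 = X

namespace IV

@[simp] theorem one_lo : (1 : IV).lo = 1 := rfl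

@[simp] theorem one_hi : (1 : IV).hi = 1 := rfl

@[simp] theorem mul_lo (X Y : IV) : (X * Y).lo = X.lo * Y.lo := rfl

@[simp] theorem mul_hi (X Y : IV) : (X * Y).hi = X.hi * Y.hi := rfl

theorem hi_nonneg (X : IV) : 0 ≤ X.hi := X.lo_nonneg.trans X.lo_le_hi

protected theorem mul_one (X : IV) : X * 1 = X := by ext <;> simp

protected theorem mul_comm (X Y : IV) : X * Y = Y * X := by ext <;> simp [mul_comm]

protected theorem mul_assoc (X Y Z : IV) : X * Y * Z = X * (Y * Z) := by
  ext <;> simp [mul_assoc]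

protected theorem mul_left_comm (X Y Z : IV) : X * (Y * Z) = Y * (X * Z) := by
  ext <;> simp [mul_left_comm]

theorem one_ipow {k₁ k₂ : ℝ} (hk₁ : 0 < k₁) (hk : k₁ ≤ k₂) : (1 : IV).ipow k₁ k₂ hk₁ hk = 1 := by
  ext <;> simp [ipow]

theorem mul_ipow (X Y : IV) {k₁ k₂ : ℝ} (hk₁ : 0 < k₁) (hk : k₁ ≤ k₂) :
    (X * Y).ipow k₁ k₂ hk₁ hk = X.ipow k₁ k₂ hk₁ hk * Y.ipow k₁ k₂ hk₁ hk := by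
  ext
  · exact Real.mul_rpow X.lo_nonneg Y.lo_nonneg
  · exact Real.mul_rpow X.hi_nonneg Y.hi_nonneg

theorem mul_self_ipow_half (X : IV) {k₁ k₂ : ℝ} (hk₁ : 0 < k₁) (hk : k₁ ≤ k₂)
    (hk₁' : 0 < k₁ / 2) (hk' : k₁ / 2 ≤ k₂ / 2) :
    (X * X).ipow (k₁ / 2) (k₂ / 2) hk₁' hk' = X.ipow k₁ k₂ hk₁ hk := by
  have key {x k : ℝ} (hx : 0 ≤ x) : (x * x) ^ (k / 2) = x ^ k := by
    rw [← sq, ← Real.rpow_natCast_mul hx]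
    congr 1
    push_cast
    ring
  ext
  · exact key X.lo_nonneg
  · exact key X.hi_nonneg

theorem exists_mul_self_eq (X : IV) : ∃ α : IV, α * α = X :=
  ⟨⟨√X.lo, √X.hi, Real.sqrt_nonneg _, Real.sqrt_le_sqrt X.lo_le_hi,
      Real.sqrt_le_one.mpr X.hi_le_one⟩,
    IV.ext (Real.mul_self_sqrt X.lo_nonneg) (Real.mul_self_sqrt X.hi_nonneg)⟩

end IV

theorem Migrative.apply_eq_apply_one {F : IV → IV → IV} (hF : Migrative F) (X Y : IV) :
    F X Y = F 1 (X * Y) := by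
  rw [← hF X 1 Y, IV.mul_one]

/-- the unique migrative function homogeneous of order
`K = [k₁,k₂]` with `F([1,1],[1,1]) = [1,1]` is `F(X,Y) = (XY)^{K/2}`. -/
theorem stmt_17 (k₁ k₂ : ℝ) (hk₁ : 0 < k₁) (hk : k₁ ≤ k₂) (F : IV → IV → IV) :
    (Migrative F ∧ (∀ α X Y : IV, F (α * X) (α * Y) = (α.ipow k₁ k₂ hk₁ hk) * F X Y) ∧
        F 1 1 = 1) ↔
      (∀ X Y : IV, F X Y =
        (X * Y).ipow (k₁ / 2) (k₂ / 2) (by linarith) (by linarith)) := by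
  have hk₁' : 0 < k₁ / 2 := by linarith
  have hk' : k₁ / 2 ≤ k₂ / 2 := by linarith
  constructor
  · rintro ⟨hmig, hhom, hone⟩ X Y
    obtain ⟨α, hα⟩ := IV.exists_mul_self_eq (X * Y)
    have h := hhom α 1 1
    rw [hone, IV.mul_one, IV.mul_one, hmig.apply_eq_apply_one, hα] at h
    rw [hmig.apply_eq_apply_one, h, ← hα, IV.mul_self_ipow_half α hk₁ hk]
  · intro h
    refine ⟨fun α X Y => ?_, fun α X Y => ?_, ?_⟩
    · rw [h, h, IV.mul_comm α X, IV.mul_assoc]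
    · rw [h, h, ← IV.mul_self_ipow_half α hk₁ hk hk₁' hk', ← IV.mul_ipow, IV.mul_assoc,
        IV.mul_assoc, IV.mul_left_comm X]
    · rw [h, IV.mul_one, IV.one_ipow]
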